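/- arXiv:2209.06891 — 2 statements merged into one kernel-verified Lean document; each statement's English description precedes it below -/
import Mathlib

section
/- Let w be a finite word over the alphabet {a,b} and let k denote the minimum of the number of a's and the number of b's in w. If 2 ≤ k ≤ 9, then s(w) ≤ ((2k−1)/(2k+2))·|w|. -/
/-- `numPowers w` is the number of distinct nonempty factors of `w` that are
powers of exponent at least 2, i.e. of the form `u^j` with `u` nonempty and `j ≥ 2`. -/
noncomputable def numPowers {α : Type*} (w : List α) : ℕ :=
  Set.ncard {v : List α | v <:+: w ∧
    ∃ u : List α, u ≠ [] ∧ ∃ j : ℕ, 2 ≤ j ∧ v = (List.replicate j u).flatten}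

/-- `numSquares w` is the number of distinct squares occurring as factors of `w`. -/
noncomputable def numSquares {α : Type*} (w : List α) : ℕ :=
  Set.ncard {v : List α | v <:+: w ∧ ∃ u : List α, u ≠ [] ∧ v = u ++ u}

/-- The binary word `a^{r 0} b a^{r 1} b ⋯ a^{r (k-1)} b a^{r k}` over the
alphabet `Bool`, where `a := false` and `b := true`. -/
def binWord (k : ℕ) (r : Fin (k + 1) → ℕ) : List Bool :=
  (List.ofFn (fun j : Fin k => List.replicate (r j.castSucc) false ++ [true])).flatten
    ++ List.replicate (r (Fin.last k)) false

/-! ### Blocks of a sequence -/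

/-- The list `g i, g (i + 1), …, g (i + L - 1)`. -/
def seqBlock {α : Type*} (g : ℕ → α) (i L : ℕ) : List α :=
  (List.range L).map fun j => g (i + j)

section SeqBlock

variable {α : Type*} {g h : ℕ → α} {i j L p : ℕ}

@[simp] theorem length_seqBlock : (seqBlock g i L).length = L := by simp [seqBlock]

theorem seqBlock_succ : seqBlock g i (L + 1) = g i :: seqBlock g (i + 1) L := by
  simp [seqBlock, List.range_succ_eq_map, Function.comp_def, Nat.add_assoc, Nat.add_comm 1]

theorem seqBlock_succ' : seqBlock g i (L + 1) = seqBlock g i L ++ [g (i + L)] := by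
  simp [seqBlock, List.range_succ]

theorem seqBlock_add (M : ℕ) : seqBlock g i (L + M) = seqBlock g i L ++ seqBlock g (i + L) M := by
  simp [seqBlock, List.range_add, Function.comp_def, Nat.add_assoc]

@[simp] theorem tail_seqBlock : (seqBlock g i (L + 1)).tail = seqBlock g (i + 1) L := by
  simp [seqBlock_succ]

@[simp] theorem dropLast_seqBlock : (seqBlock g i (L + 1)).dropLast = seqBlock g i L := by
  simp [seqBlock_succ']

theorem seqBlock_eq_iff : seqBlock g i L = seqBlock h j L ↔ ∀ m < L, g (i + m) = h (j + m) := by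
  simp [seqBlock]

theorem mem_seqBlock {x : α} : x ∈ seqBlock g i L ↔ ∃ m < L, g (i + m) = x := by
  simp [seqBlock]

theorem seqBlock_infix {i' L' : ℕ} (h₁ : i ≤ i') (h₂ : i' + L' ≤ i + L) :
    seqBlock g i' L' <:+: seqBlock g i L := by
  obtain ⟨d, rfl⟩ := Nat.exists_eq_add_of_le h₁
  obtain ⟨e, rfl⟩ : ∃ e, L = d + L' + e := ⟨L - d - L', by omega⟩
  exact ⟨seqBlock g i d, seqBlock g (i + (d + L')) e, by rw [seqBlock_add, seqBlock_add]⟩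

theorem seqBlock_add_period (hp : Function.Periodic g p) (m : ℕ) :
    seqBlock g (i + m * p) L = seqBlock g i L := by
  rw [seqBlock_eq_iff]
  intro k _
  rw [Nat.add_right_comm]
  exact hp.nat_mul m _

theorem append_self_seqBlock {m : ℕ} (hg : Function.Periodic g p) :
    seqBlock g i (m * p) ++ seqBlock g i (m * p) = seqBlock g i (2 * m * p) := by
  rw [Nat.mul_assoc, Nat.two_mul, seqBlock_add, seqBlock_add_period hg]

theorem seqBlock_mod (hp : Function.Periodic g p) : seqBlock g (i % p) L = seqBlock g i L := by
  conv_rhs => rw [← Nat.mod_add_div i p, Nat.mul_comm]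
  exact (seqBlock_add_period hp _).symm

/-- Every list is a block of a sequence, and so are its factors. -/
theorem exists_seqBlock_eq [Inhabited α] (w : List α) : ∃ f : ℕ → α, w = seqBlock f 0 w.length :=
  ⟨fun j => w.getD j default, List.ext_getElem (by simp) fun n h₁ _ => by simp [seqBlock, h₁]⟩

theorem infix_seqBlock_iff {f : ℕ → α} {n : ℕ} {v : List α} :
    v <:+: seqBlock f 0 n ↔ ∃ i, i + v.length ≤ n ∧ v = seqBlock f i v.length := by
  constructor
  · rintro ⟨s, t, h⟩
    have hn : n = s.length + v.length + t.length := by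
      have := congrArg List.length h
      simp at this
      omega
    refine ⟨s.length, by omega, ?_⟩
    rw [hn, seqBlock_add, seqBlock_add] at h
    have h₁ := List.append_inj h (by simp)
    simpa using (List.append_inj h₁.1 (by simp)).2
  · rintro ⟨i, hi, h⟩
    rw [h]
    exact seqBlock_infix (Nat.zero_le _) (by omega)

/-- If `c + 1` blocks of length `L` starting within one period occur in `w`, then all blocks of
length `L - p + c + 1` do. -/
theorem forall_seqBlock_infix_of_count {w : List α} {c : ℕ}
    [DecidablePred fun i => seqBlock g i L <:+: w]
    (hp : 0 < p) (hg : Function.Periodic g p) (hpL : p ≤ L)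
    (hip : i < p) (hi : seqBlock g i L <:+: w)
    (hc : c = Nat.count (fun i => seqBlock g i L <:+: w) i) (x : ℕ) :
    seqBlock g x (L - p + c + 1) <:+: w := by
  have hlt : c < Nat.count (fun i => seqBlock g i L <:+: w) p := hc ▸ Nat.count_strict_mono hi hip
  have hle : c ≤ i := hc ▸ Nat.count_le _
  set G := (Finset.range p).filter fun i => seqBlock g i L <:+: w with hG
  have hGc : c < G.card := by rwa [Nat.count_eq_card_filter_range] at hlt
  set B := (Finset.range (p - c)).image fun s => (x + c + 1 + s) % p with hB
  have hBc : B.card = p - c := by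
    rw [hB, Finset.card_image_of_injOn, Finset.card_range]
    intro s hs t ht hst
    simp only [Finset.coe_range, Set.mem_Iio] at hs ht
    have hst' : s ≡ t [MOD p] := Nat.ModEq.add_left_cancel' _ hst
    exact hst'.eq_of_lt_of_lt (by omega) (by omega)
  obtain ⟨y, hy⟩ := Finset.inter_nonempty_of_card_lt_card_add_card (s := Finset.range p)
    (t := G) (u := B) (Finset.filter_subset _ _)
    (Finset.image_subset_iff.2 fun s _ => Finset.mem_range.2 (Nat.mod_lt _ hp))
    (by rw [hBc, Finset.card_range]; omega)
  obtain ⟨hyG, hyB⟩ := Finset.mem_inter.1 hy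
  obtain ⟨s, hs, rfl⟩ := Finset.mem_image.1 hyB
  have hw := (Finset.mem_filter.1 hyG).2
  rw [seqBlock_mod hg] at hw
  rw [Finset.mem_range] at hs
  rw [← seqBlock_add_period hg 1]
  exact (seqBlock_infix (by omega) (by omega)).trans hw

end SeqBlock

/-! ### Lyndon sequences -/

/-- A periodic sequence of least period `p` that is lexicographically minimal among its shifts. -/
structure IsLyndonSeq {α : Type*} [LinearOrder α] (g : ℕ → α) (p : ℕ) : Prop where
  pos : 0 < p
  periodic : Function.Periodic g p
  least : ∀ q, 0 < q → q < p → ¬ Function.Periodic g q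
  le_shift : ∀ i, toLex g ≤ toLex fun j => g (i + j)

section Lyndon

variable {α : Type*} [LinearOrder α] {g h : ℕ → α} {p q : ℕ}

theorem toLex_shift_le {u v : ℕ → α} (huv : toLex u ≤ toLex v) {m : ℕ}
    (heq : ∀ j < m, u j = v j) : toLex (fun j => u (m + j)) ≤ toLex fun j => v (m + j) := by
  rcases huv.eq_or_lt with huv | ⟨k, hk, hlt⟩
  · rw [toLex_inj] at huv
    rw [huv]
  · have hmk : m ≤ k := by
      by_contra! hkm
      exact hlt.ne (heq k hkm)
    refine le_of_lt ⟨k - m, fun j hj => hk (m + j) (by omega), ?_⟩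
    have : m + (k - m) = k := by omega
    simpa [this] using hlt

/-- The first period of a Lyndon sequence is unbordered. -/
theorem IsLyndonSeq.unbordered (hg : IsLyndonSeq g p) (hq : 0 < q) (hqp : q < p) :
    ¬ ∀ j, j + q < p → g j = g (j + q) := by
  intro hb
  have h₁ := toLex_shift_le (hg.le_shift q) (m := p - q) fun j hj => by
    rw [Nat.add_comm q]
    exact hb j (by omega)
  have h₂ : (fun j => g (q + (p - q + j))) = g := by
    funext j
    rw [← Nat.add_assoc, Nat.add_sub_of_le hqp.le, Nat.add_comm]
    exact hg.periodic j
  rw [h₂] at h₁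
  have h₃ := toLex_inj.1 (le_antisymm h₁ (hg.le_shift (p - q)))
  refine hg.least (p - q) (by omega) (by omega) fun x => ?_
  rw [Nat.add_comm]
  exact congrFun h₃ x

/-- If a long enough prefix of a Lyndon sequence occurs in another one, then its period is at most
that of the other one, with equality only if the two sequences agree. -/
theorem IsLyndonSeq.period_le_of_seqBlock_eq (hg : IsLyndonSeq g p) (hh : IsLyndonSeq h q)
    {i L : ℕ} (hp : p ≤ L) (hq : q ≤ L) (he : seqBlock h 0 L = seqBlock g i L) :
    q < p ∨ q = p ∧ h = g ∧ p ∣ i := by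
  rw [seqBlock_eq_iff] at he
  simp only [Nat.zero_add] at he
  rcases lt_trichotomy q p with hlt | rfl | hlt
  · exact Or.inl hlt
  · refine Or.inr ⟨rfl, ?_⟩
    have hfun : h = fun j => g (i + j) := by
      funext j
      have h₁ := he (j % q) ((Nat.mod_lt _ hg.pos).trans_le hp)
      rw [hh.periodic.map_mod_nat] at h₁
      rw [h₁]
      conv_rhs => rw [← Nat.mod_add_div j q, ← Nat.add_assoc, Nat.mul_comm]
      exact (hg.periodic.nat_mul _ _).symm
    have hgh : h = g := by
      apply toLex_inj.1
      apply le_antisymm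
      · have h₂ := hh.le_shift (q * (i + 1) - i)
        convert h₂ using 2
        funext j
        have hle : i ≤ q * (i + 1) := by nlinarith [hg.pos]
        rw [hfun]
        simp only
        rw [← Nat.add_assoc, Nat.add_sub_of_le hle, Nat.add_comm, Nat.mul_comm]
        exact (hg.periodic.nat_mul _ _).symm
      · rw [hfun]
        exact hg.le_shift i
    refine ⟨hgh, ?_⟩
    rw [Nat.dvd_iff_mod_eq_zero]
    by_contra hne
    refine hg.least (i % q) (Nat.pos_of_ne_zero hne) (Nat.mod_lt _ hg.pos) fun x => ?_
    have h₃ : g x = g (i + x) := by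
      conv_lhs => rw [← hgh, hfun]
    rw [h₃]
    conv_rhs => rw [← Nat.mod_add_div i q, Nat.mul_comm, Nat.add_right_comm, Nat.add_comm (i % q)]
    exact (hg.periodic.nat_mul _ _).symm
  · exact absurd (fun j hj => by
      rw [he j (by omega), he (j + p) (by omega), ← Nat.add_assoc]
      exact (hg.periodic _).symm) (hh.unbordered hg.pos hlt)

/-- Every nonempty list is a power of a factor, of length the period, of a Lyndon sequence. -/
theorem exists_isLyndonSeq {u : List α} (hu : u ≠ []) :
    ∃ (g : ℕ → α) (p i m : ℕ), IsLyndonSeq g p ∧ i < p ∧ 0 < m ∧ u = seqBlock g i (m * p) := by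
  classical
  have hd : 0 < u.length := List.length_pos_of_ne_nil hu
  set f : ℕ → α := fun j => u[j % u.length]'(Nat.mod_lt _ hd) with hf
  have hfd : Function.Periodic f u.length := fun x => by simp [hf]
  have hfu : u = seqBlock f 0 u.length :=
    List.ext_getElem (by simp) fun n h₁ _ => by simp [seqBlock, hf, Nat.mod_eq_of_lt h₁]
  have hex : ∃ p, 0 < p ∧ Function.Periodic f p := ⟨_, hd, hfd⟩
  obtain ⟨hp0, hp⟩ := Nat.find_spec hex
  have hmin : ∀ q, 0 < q → q < Nat.find hex → ¬ Function.Periodic f q := fun q h₀ h₁ h₂ =>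
    Nat.find_min hex h₁ ⟨h₀, h₂⟩
  generalize Nat.find hex = p at hp0 hp hmin
  have hdvd : p ∣ u.length := by
    rw [Nat.dvd_iff_mod_eq_zero]
    by_contra hne
    refine hmin _ (Nat.pos_of_ne_zero hne) (Nat.mod_lt _ hp0) fun x => ?_
    rw [← hp.nat_mul (u.length / p) (x + u.length % p), Nat.add_assoc, Nat.cast_id, Nat.mul_comm,
      Nat.mod_add_div]
    exact hfd x
  obtain ⟨m, hm⟩ := hdvd
  obtain ⟨s, hs, hsmin⟩ := Finset.exists_min_image (Finset.range p)
    (fun i => toLex fun j => f (i + j)) ⟨0, by simpa using hp0⟩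
  rw [Finset.mem_range] at hs
  have hper : ∀ q, Function.Periodic (fun j => f (s + j)) q → Function.Periodic f q := by
    intro q hq x
    have h₁ := hq (x + s * (p - 1))
    have h₂ : s + (x + s * (p - 1)) = x + s * p := by
      obtain ⟨r, rfl⟩ := Nat.exists_eq_add_of_lt hp0
      simp
      ring
    have h₃ : s + (x + s * (p - 1) + q) = x + q + s * p := by omega
    simp only [h₂, h₃] at h₁
    have h₄ := hp.nat_mul s (x + q)
    have h₅ := hp.nat_mul s x
    simp only [Nat.cast_id] at h₄ h₅
    rw [← h₄, ← h₅, h₁]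
  refine ⟨fun j => f (s + j), p, (p - s) % p, m, ⟨hp0, fun x => ?_, fun q h₀ h₁ h₂ =>
    hmin q h₀ h₁ (hper q h₂), fun i => ?_⟩, Nat.mod_lt _ hp0, ?_, ?_⟩
  · simp only [← Nat.add_assoc]
    exact hp _
  · refine (hsmin ((s + i) % p) (by simpa using Nat.mod_lt _ hp0)).trans (le_of_eq ?_)
    congr 1
    funext j
    conv_rhs => rw [← Nat.add_assoc, ← Nat.mod_add_div (s + i) p, Nat.mul_comm p, Nat.add_right_comm]
    exact (hp.nat_mul _ _).symm
  · rcases Nat.eq_zero_or_pos m with rfl | h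
    · omega
    · exact h
  · rw [Nat.mul_comm m, ← hm, hfu, length_seqBlock, seqBlock_eq_iff]
    intro j _
    rw [Nat.zero_add, ← Nat.add_assoc]
    rcases Nat.eq_zero_or_pos s with rfl | hs0
    · simp
    · rw [Nat.mod_eq_of_lt (by omega), Nat.add_sub_of_le hs.le, Nat.add_comm]
      exact (hp j).symm

end Lyndon

/-! ### Factors and Rauzy graphs -/

/-- A finite graph on which every function invariant along the edges is constant has at most one
more vertex than it has edges. -/
theorem card_le_card_add_one_of_invariant_const {V E : Type*} (s : Finset V) (t : Finset E)
    (src tgt : E → V)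
    (h : ∀ φ : V → ℚ, (∀ e ∈ t, φ (src e) = φ (tgt e)) → ∀ x ∈ s, ∀ y ∈ s, φ x = φ y) :
    s.card ≤ t.card + 1 := by
  classical
  rcases s.eq_empty_or_nonempty with rfl | ⟨x₀, hx₀⟩
  · simp
  let ext : (s → ℚ) →ₗ[ℚ] (V → ℚ) :=
    { toFun := fun φ v => if hv : v ∈ s then φ ⟨v, hv⟩ else 0
      map_add' := fun φ ψ => by
        funext v
        by_cases hv : v ∈ s <;> simp [hv]
      map_smul' := fun c φ => by
        funext v
        by_cases hv : v ∈ s <;> simp [hv] }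
  let T : (s → ℚ) →ₗ[ℚ] (t → ℚ) × ℚ :=
    { toFun := fun φ => (fun e => ext φ (src e) - ext φ (tgt e), φ ⟨x₀, hx₀⟩)
      map_add' := fun φ ψ => by
        ext e
        · simp
          ring
        · simp
      map_smul' := fun c φ => by
        ext e
        · simp
          ring
        · simp }
  have hT : Function.Injective T := by
    rw [injective_iff_map_eq_zero]
    intro φ hφ
    have h₁ : ∀ e ∈ t, ext φ (src e) = ext φ (tgt e) := fun e he =>
      sub_eq_zero.1 (congrFun (congrArg Prod.fst hφ) ⟨e, he⟩)
    have h₂ : φ ⟨x₀, hx₀⟩ = 0 := congrArg Prod.snd hφ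
    funext v
    have h₃ := h _ h₁ v v.2 x₀ hx₀
    simp only [ext, LinearMap.coe_mk, AddHom.coe_mk, dif_pos v.2, dif_pos hx₀] at h₃
    exact h₃.trans h₂
  simpa using LinearMap.finrank_le_finrank_of_injective hT

theorem exists_replicate_append_infix_of_le {α : Type*} {w : List α} {a b : α} {l N : ℕ} (hl : l ≤ N)
    (hN : ∃ t, List.replicate N a ++ (b :: t) ++ List.replicate N a <:+: w) :
    ∃ t, List.replicate l a ++ [b] ++ (t ++ List.replicate l a) <:+: w := by
  obtain ⟨t, ht⟩ := hN
  obtain ⟨d, rfl⟩ := Nat.exists_eq_add_of_le' hl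
  refine ⟨t, List.IsInfix.trans ⟨List.replicate d a, List.replicate d a, ?_⟩ ht⟩
  conv_rhs => enter [2]; rw [Nat.add_comm]
  simp only [List.replicate_add, List.append_assoc, List.cons_append, List.nil_append]

section Factors

variable {α : Type*} [DecidableEq α]

/-- The factors of `w` of length `l`. -/
def factorsOfLength (w : List α) (l : ℕ) : Finset (List α) :=
  (Finset.range (w.length + 1 - l)).image fun i => (w.drop i).take l

theorem mem_factorsOfLength {w v : List α} {l : ℕ} :
    v ∈ factorsOfLength w l ↔ v <:+: w ∧ v.length = l := by
  simp only [factorsOfLength, Finset.mem_image, Finset.mem_range]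
  constructor
  · rintro ⟨i, hi, rfl⟩
    refine ⟨(List.take_prefix _ _).isInfix.trans (List.drop_suffix _ _).isInfix, ?_⟩
    simp
    omega
  · rintro ⟨⟨s, t, rfl⟩, rfl⟩
    refine ⟨s.length, ?_, ?_⟩
    · simp
      omega
    · simp

theorem card_factorsOfLength_zero (w : List α) : (factorsOfLength w 0).card = 1 := by
  rw [Finset.card_eq_one]
  refine ⟨[], ?_⟩
  ext v
  rw [mem_factorsOfLength, Finset.mem_singleton]
  constructor
  · rintro ⟨-, h⟩
    exact List.length_eq_zero_iff.1 h
  · rintro rfl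
    exact ⟨List.nil_infix, rfl⟩

theorem card_factorsOfLength_length (w : List α) : (factorsOfLength w w.length).card = 1 := by
  rw [Finset.card_eq_one]
  refine ⟨w, ?_⟩
  ext v
  rw [mem_factorsOfLength, Finset.mem_singleton]
  constructor
  · rintro ⟨h, h'⟩
    exact h.eq_of_length h'
  · rintro rfl
    exact ⟨List.infix_rfl, rfl⟩

/-- If the edges in `A` can be removed from the Rauzy graph of order `l` without disconnecting it,
then there are at most as many of them as its cyclomatic number. -/
theorem card_factorsOfLength_add_card_le [Inhabited α] (w : List α) (l : ℕ) (A : Finset (List α))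
    (hA : A ⊆ factorsOfLength w (l + 1))
    (h : ∀ φ : List α → ℚ,
      (∀ e ∈ factorsOfLength w (l + 1), e ∉ A → φ e.dropLast = φ e.tail) →
        ∀ e ∈ A, φ e.dropLast = φ e.tail) :
    (factorsOfLength w l).card + A.card ≤ (factorsOfLength w (l + 1)).card + 1 := by
  have h₁ : (factorsOfLength w l).card ≤ (factorsOfLength w (l + 1) \ A).card + 1 := by
    refine card_le_card_add_one_of_invariant_const _ _ List.dropLast List.tail fun φ hφ => ?_
    have hall : ∀ e ∈ factorsOfLength w (l + 1), φ e.dropLast = φ e.tail := by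
      have h₂ : ∀ e ∈ factorsOfLength w (l + 1), e ∉ A → φ e.dropLast = φ e.tail :=
        fun e he heA => hφ e (Finset.mem_sdiff.2 ⟨he, heA⟩)
      intro e he
      by_cases heA : e ∈ A
      · exact h φ h₂ e heA
      · exact h₂ e he heA
    obtain ⟨f, hf⟩ := exists_seqBlock_eq w
    have hstep : ∀ i, i + l ≤ w.length → φ (seqBlock f i l) = φ (seqBlock f 0 l) := by
      intro i
      induction i with
      | zero => simp
      | succ i ih =>
        intro hi
        rw [← ih (by omega)]
        have := hall (seqBlock f i (l + 1)) (mem_factorsOfLength.2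
          ⟨by rw [hf]; exact seqBlock_infix (Nat.zero_le _) (by omega), by simp⟩)
        simpa using this.symm
    have hconst : ∀ x ∈ factorsOfLength w l, φ x = φ (seqBlock f 0 l) := by
      intro x hx
      obtain ⟨hxw, hxl⟩ := mem_factorsOfLength.1 hx
      rw [hf] at hxw
      obtain ⟨i, hi, hxi⟩ := infix_seqBlock_iff.1 hxw
      rw [hxi, hxl]
      exact hstep i (hxl ▸ hi)
    intro x hx y hy
    rw [hconst x hx, hconst y hy]
  have h₂ := Finset.card_sdiff_add_card_eq_card hA
  omega

end Factors

section CycleFactors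

variable {α : Type*} [LinearOrder α]

open Classical in
/-- The factors of `w` of length `l + 1` that are prefixes of a Lyndon sequence of period at most
`l`, not identically `a`, all of whose blocks of length `l + 1` occur in `w`. Each of them
represents one short cycle of the Rauzy graph of order `l`. -/
noncomputable def cycleFactors (w : List α) (a : α) (l : ℕ) : Finset (List α) :=
  (factorsOfLength w (l + 1)).filter fun e => ∃ (g : ℕ → α) (p : ℕ), IsLyndonSeq g p ∧ p ≤ l ∧
    (∃ x, g x ≠ a) ∧ e = seqBlock g 0 (l + 1) ∧ ∀ i, seqBlock g i (l + 1) <:+: w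

theorem mem_cycleFactors {w : List α} {a : α} {l : ℕ} {e : List α} :
    e ∈ cycleFactors w a l ↔ ∃ (g : ℕ → α) (p : ℕ), IsLyndonSeq g p ∧ p ≤ l ∧
    (∃ x, g x ≠ a) ∧ e = seqBlock g 0 (l + 1) ∧ ∀ i, seqBlock g i (l + 1) <:+: w := by
  classical
  rw [cycleFactors, Finset.mem_filter, and_iff_right_of_imp]
  rintro ⟨g, p, -, -, -, rfl, h⟩
  exact mem_factorsOfLength.2 ⟨h 0, by simp⟩

theorem IsLyndonSeq.exists_lt_ne {g : ℕ → α} {p : ℕ} (hg : IsLyndonSeq g p) {a : α}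
    (ha : ∃ x, g x ≠ a) {l : ℕ} (hl : p ≤ l) (i : ℕ) : ∃ m < l, g (i + m) ≠ a := by
  obtain ⟨x, hx⟩ := ha
  have hle : i ≤ x + i * p := le_add_left (Nat.le_mul_of_pos_right _ hg.pos)
  refine ⟨(x + i * p - i) % p, (Nat.mod_lt _ hg.pos).trans_le hl, ?_⟩
  have h₁ := hg.periodic.nat_mul ((x + i * p - i) / p) (i + (x + i * p - i) % p)
  rw [Nat.cast_id, Nat.add_assoc, Nat.mul_comm (_ / p), Nat.mod_add_div,
    Nat.add_sub_of_le hle] at h₁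
  rw [← h₁]
  exact (hg.periodic.nat_mul i x).trans_ne hx

/-- Removing the representatives of the short cycles other than the loop at `a ^ l`, and a set of
edges starting at `a ^ l` that are not needed for connectedness, keeps all ends connected. -/
theorem cycleFactors_invariant {w : List α} {a : α} {l : ℕ} {A : Finset (List α)}
    (hA : ∀ e ∈ A, ∃ b, e = List.replicate l a ++ [b]) {φ : List α → ℚ}
    (h : ∀ e ∈ factorsOfLength w (l + 1), e ∉ cycleFactors w a l ∪ A → φ e.dropLast = φ e.tail) :
    ∀ e ∈ factorsOfLength w (l + 1), e ∉ A → φ e.dropLast = φ e.tail := by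
  have key : ∀ n p, p < n → ∀ g : ℕ → α, IsLyndonSeq g p → p ≤ l → (∃ x, g x ≠ a) →
      (∀ i, seqBlock g i (l + 1) <:+: w) → φ (seqBlock g 0 l) = φ (seqBlock g 1 l) := by
    intro n
    induction n with
    | zero => simp
    | succ n ih =>
      intro p hpn g hg hpl ha hw
      have hchain : ∀ i, i + 1 ≤ p → φ (seqBlock g (i + 1) l) = φ (seqBlock g 1 l) := by
        intro i
        induction i with
        | zero => simp
        | succ i ihi =>
          intro hi
          rw [← ihi (by omega)]
          have hmem : seqBlock g (i + 1) (l + 1) ∈ factorsOfLength w (l + 1) :=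
            mem_factorsOfLength.2 ⟨hw _, by simp⟩
          by_cases hc : seqBlock g (i + 1) (l + 1) ∈ cycleFactors w a l
          · obtain ⟨g', q, hg', hql, ha', heq, hw'⟩ := mem_cycleFactors.1 hc
            rcases hg.period_le_of_seqBlock_eq hg' (by omega) (by omega) heq.symm with
              hlt | ⟨-, -, hdvd⟩
            · have h₁ := ih q (by omega) g' hg' hql ha' hw'
              have h₂ := congrArg List.dropLast heq
              have h₃ := congrArg List.tail heq
              simp only [dropLast_seqBlock, tail_seqBlock] at h₂ h₃
              rw [h₂, h₃, h₁]
            · have := Nat.le_of_dvd (by omega) hdvd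
              omega
          · have hnA : seqBlock g (i + 1) (l + 1) ∉ A := by
              intro hmA
              obtain ⟨b, hb⟩ := hA _ hmA
              rw [seqBlock_succ'] at hb
              have hb₁ := (List.append_inj hb (by simp)).1
              obtain ⟨m, hm, hne⟩ := hg.exists_lt_ne ha hpl (i + 1)
              exact hne (List.eq_of_mem_replicate (hb₁ ▸ mem_seqBlock.2 ⟨m, hm, rfl⟩))
            have h₁ := h _ hmem (by simp [hc, hnA])
            simpa using h₁.symm
      have h₁ := hchain (p - 1) (by have := hg.pos; omega)
      have h₂ := seqBlock_add_period hg.periodic (i := 0) (L := l) 1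
      have h₃ : p - 1 + 1 = 0 + 1 * p := by have := hg.pos; omega
      rw [h₃, h₂] at h₁
      exact h₁
  intro e he heA
  by_cases hc : e ∈ cycleFactors w a l
  · obtain ⟨g, p, hg, hpl, ha, rfl, hw⟩ := mem_cycleFactors.1 hc
    simpa using key (p + 1) p (by omega) g hg hpl ha hw
  · exact h e he (by simp [hc, heA])

theorem card_factorsOfLength_add_card_cycleFactors_le [Inhabited α] {w : List α} {a b : α}
    (hab : a ≠ b) (l : ℕ) {M N : ℕ} (hM : List.replicate M a <:+: w)
    (hN : ∃ t, List.replicate N a ++ (b :: t) ++ List.replicate N a <:+: w) :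
    (factorsOfLength w l).card + ((cycleFactors w a l).card + (if l < M then 1 else 0) +
      (if l ≤ N then 1 else 0)) ≤ (factorsOfLength w (l + 1)).card + 1 := by
  classical
  set A₁ : Finset (List α) := if l < M then {List.replicate l a ++ [a]} else ∅ with hA₁
  set A₂ : Finset (List α) := if l ≤ N then {List.replicate l a ++ [b]} else ∅ with hA₂
  have hmem₁ : ∀ e ∈ A₁, l < M ∧ e = List.replicate l a ++ [a] := by
    intro e he
    by_cases hl : l < M <;> simp_all
  have hmem₂ : ∀ e ∈ A₂, l ≤ N ∧ e = List.replicate l a ++ [b] := by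
    intro e he
    by_cases hl : l ≤ N <;> simp_all
  have hA : ∀ e ∈ A₁ ∪ A₂, ∃ b, e = List.replicate l a ++ [b] := by
    intro e he
    rcases Finset.mem_union.1 he with he | he
    · exact ⟨a, (hmem₁ e he).2⟩
    · exact ⟨b, (hmem₂ e he).2⟩
  have hdisj₁ : Disjoint A₁ A₂ := by
    rw [Finset.disjoint_left]
    intro e h₁ h₂
    have := (hmem₁ e h₁).2.symm.trans (hmem₂ e h₂).2
    simp at this
    exact hab this
  have hdisj₂ : Disjoint (cycleFactors w a l) (A₁ ∪ A₂) := by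
    rw [Finset.disjoint_left]
    intro e h₁ h₂
    obtain ⟨c, hc⟩ := hA e h₂
    obtain ⟨g, p, hg, hpl, ha, rfl, -⟩ := mem_cycleFactors.1 h₁
    rw [seqBlock_succ'] at hc
    have hc₁ := (List.append_inj hc (by simp)).1
    obtain ⟨m, hm, hne⟩ := hg.exists_lt_ne ha hpl 0
    exact hne (List.eq_of_mem_replicate (hc₁ ▸ mem_seqBlock.2 ⟨m, hm, rfl⟩))
  have hsub : cycleFactors w a l ∪ (A₁ ∪ A₂) ⊆ factorsOfLength w (l + 1) := by
    refine Finset.union_subset (Finset.filter_subset _ _) (Finset.union_subset ?_ ?_)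
    · intro e he
      obtain ⟨hl, rfl⟩ := hmem₁ e he
      refine mem_factorsOfLength.2 ⟨List.IsInfix.trans ⟨[], List.replicate (M - (l + 1)) a, ?_⟩ hM,
        by simp⟩
      rw [← List.replicate_succ', List.nil_append, List.replicate_append_replicate]
      congr 1
      omega
    · intro e he
      obtain ⟨hl, rfl⟩ := hmem₂ e he
      obtain ⟨t, ht⟩ := exists_replicate_append_infix_of_le hl hN
      exact mem_factorsOfLength.2 ⟨(List.prefix_append _ _).isInfix.trans ht, by simp⟩
  have hcard : (cycleFactors w a l ∪ (A₁ ∪ A₂)).card =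
      (cycleFactors w a l).card + (if l < M then 1 else 0) + (if l ≤ N then 1 else 0) := by
    rw [Finset.card_union_of_disjoint hdisj₂, Finset.card_union_of_disjoint hdisj₁, ← Nat.add_assoc,
      hA₁, hA₂]
    congr 2 <;> split_ifs <;> simp
  rw [← hcard]
  refine card_factorsOfLength_add_card_le w l _ hsub fun φ hφ => ?_
  have hinv := cycleFactors_invariant hA hφ
  suffices hA' : ∀ e ∈ A₁ ∪ A₂, φ e.dropLast = φ e.tail by
    intro e he
    by_cases heA : e ∈ A₁ ∪ A₂
    · exact hA' e heA
    · exact hinv e (hsub he) heA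
  intro e he
  rcases Finset.mem_union.1 he with he | he
  · obtain ⟨-, rfl⟩ := hmem₁ e he
    rw [← List.replicate_succ']
    simp
  · obtain ⟨hl, rfl⟩ := hmem₂ e he
    obtain ⟨t, ht⟩ := exists_replicate_append_infix_of_le hl hN
    obtain ⟨f, hf⟩ := exists_seqBlock_eq w
    have hi : ∃ i, seqBlock f i (l + 1) = List.replicate l a ++ [b] ∧
        ∃ j, i < j ∧ j + l ≤ w.length ∧ seqBlock f j l = List.replicate l a := by
      rw [hf] at ht
      obtain ⟨i, hin, hi⟩ := infix_seqBlock_iff.1 ht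
      rw [List.length_append, seqBlock_add] at hi
      have h₁ := List.append_inj hi (by simp)
      have h₂ := h₁.2
      rw [List.length_append (as := t), seqBlock_add] at h₂
      have h₃ := List.append_inj h₂ (by simp)
      simp only [List.length_append, List.length_replicate, List.length_singleton] at h₁ h₃ hin
      exact ⟨i, h₁.1.symm, _, by omega, by omega, h₃.2.symm⟩
    obtain ⟨i, hi, j, hij, hjn, hj⟩ := hi
    have hex : ∃ j, i < j ∧ j + l ≤ w.length ∧ seqBlock f j l = List.replicate l a :=
      ⟨j, hij, hjn, hj⟩
    obtain ⟨hij, hjn, hj⟩ := Nat.find_spec hex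
    have hmin : ∀ m, i < m → m < Nat.find hex → seqBlock f m l ≠ List.replicate l a := by
      intro m h₁ h₂ h₃
      exact Nat.find_min hex h₂ ⟨h₁, by omega, h₃⟩
    generalize Nat.find hex = j at hij hjn hj hmin
    have hchain : ∀ m, i + 1 ≤ m → m ≤ j → φ (seqBlock f m l) = φ (seqBlock f (i + 1) l) := by
      intro m hm
      induction m, hm using Nat.le_induction with
      | base => simp
      | succ m hm ih =>
        intro hmj
        rw [← ih (by omega)]
        have := hinv (seqBlock f m (l + 1)) (mem_factorsOfLength.2
          ⟨by rw [hf]; exact seqBlock_infix (Nat.zero_le _) (by omega), by simp⟩) fun hmA => by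
            obtain ⟨c, hc⟩ := hA _ hmA
            rw [seqBlock_succ'] at hc
            exact hmin m (by omega) (by omega) (List.append_inj hc (by simp)).1
        simpa using this.symm
    have h₁ := hchain j (by omega) le_rfl
    rw [← hi, tail_seqBlock, ← h₁, hj, hi]
    simp

theorem sum_card_cycleFactors_add_le [Inhabited α] {w : List α} {a b : α} (hab : a ≠ b)
    {M N : ℕ} (hM : List.replicate M a <:+: w)
    (hN : ∃ t, List.replicate N a ++ (b :: t) ++ List.replicate N a <:+: w) :
    ∑ l ∈ Finset.range w.length, (cycleFactors w a l).card + M + N + 1 ≤ w.length := by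
  have hMn : M ≤ w.length := by simpa using hM.length_le
  have hNn : N + 1 ≤ w.length := by
    obtain ⟨t, ht⟩ := hN
    have := ht.length_le
    simp at this
    omega
  have h := Finset.sum_le_sum fun l (_ : l ∈ Finset.range w.length) =>
    card_factorsOfLength_add_card_cycleFactors_le hab l hM hN
  have hcount : ∀ K ≤ w.length, ∑ l ∈ Finset.range w.length, (if l < K then 1 else 0) = K := by
    intro K hK
    have hfil : (Finset.range w.length).filter (· < K) = Finset.range K := by
      ext x
      simp only [Finset.mem_filter, Finset.mem_range]
      omega
    rw [← Finset.card_filter, hfil, Finset.card_range]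
  have hsum := Finset.sum_range_succ (fun l => (factorsOfLength w l).card) w.length
  rw [Finset.sum_range_succ', card_factorsOfLength_zero, card_factorsOfLength_length] at hsum
  have h₁ := hcount M hMn
  have h₂ := hcount (N + 1) hNn
  simp only [Nat.lt_succ_iff] at h₂
  simp only [Finset.sum_add_distrib, Finset.sum_const, Finset.card_range, smul_eq_mul,
    Nat.mul_one, h₁, h₂] at h
  omega

/-! ### Squares and cubes -/

theorem ncard_squares_add_le [Inhabited α] (w : List α) (a : α) :
    Set.ncard {v : List α | v <:+: w ∧ (∃ u, u ≠ [] ∧ v = u ++ u) ∧ ∃ x ∈ v, x ≠ a} +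
      (open Classical in if ∃ u, (∃ x ∈ u, x ≠ a) ∧ u ++ u ++ u <:+: w then 1 else 0) ≤
    ∑ l ∈ Finset.range w.length, (cycleFactors w a l).card := by
  classical
  set S := {v : List α | v <:+: w ∧ (∃ u, u ≠ [] ∧ v = u ++ u) ∧ ∃ x ∈ v, x ≠ a} with hS
  have hroot : ∀ v : S, ∃ (g : ℕ → α) (p i m : ℕ), IsLyndonSeq g p ∧ i < p ∧ 0 < m ∧
      (∃ x, g x ≠ a) ∧ v.1 = seqBlock g i (2 * m * p) := by
    rintro ⟨v, -, ⟨u, hu, rfl⟩, x, hx, hxa⟩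
    obtain ⟨g, p, i, m, hg, hi, hm, rfl⟩ := exists_isLyndonSeq hu
    rw [append_self_seqBlock hg.periodic] at hx
    obtain ⟨k, -, rfl⟩ := mem_seqBlock.1 hx
    exact ⟨g, p, i, m, hg, hi, hm, ⟨_, hxa⟩, append_self_seqBlock hg.periodic⟩
  choose g p i m hg hi hm hga hv using hroot
  have hmem : ∀ {g : ℕ → α} {p l : ℕ}, IsLyndonSeq g p → (∃ x, g x ≠ a) → p ≤ l →
      (∀ x, seqBlock g x (l + 1) <:+: w) →
      (⟨l, seqBlock g 0 (l + 1)⟩ : Σ _ : ℕ, List α) ∈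
        (Finset.range w.length).sigma (cycleFactors w a) := by
    intro g p l hg ha hpl hw
    refine Finset.mem_sigma.2 ⟨?_, mem_cycleFactors.2 ⟨g, p, hg, hpl, ha, rfl, hw⟩⟩
    have := (hw 0).length_le
    rw [length_seqBlock] at this
    exact Finset.mem_range.2 this
  let c : S → ℕ := fun v => Nat.count (fun i => seqBlock (g v) i (2 * m v * p v) <:+: w) (i v)
  have hcp : ∀ v, c v < p v := fun v => (Nat.count_le _).trans_lt (hi v)
  let l : S → ℕ := fun v => (2 * m v - 1) * p v + c v
  have hl : ∀ v, l v + 1 = 2 * m v * p v - p v + c v + 1 := fun v => by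
    simp only [l, Nat.sub_mul, Nat.one_mul]
  have hpl : ∀ v, p v ≤ l v := fun v =>
    (Nat.le_mul_of_pos_left _ (by have := hm v; omega)).trans (Nat.le_add_right _ _)
  let F : S → Σ _ : ℕ, List α := fun v => ⟨l v, seqBlock (g v) 0 (l v + 1)⟩
  have hdiv : ∀ v, l v / p v = 2 * m v - 1 := fun v => by
    simp only [l]
    rw [Nat.mul_comm, Nat.mul_add_div (hg v).pos, Nat.div_eq_of_lt (hcp v), Nat.add_zero]
  have huniq : ∀ (v : S) {g' : ℕ → α} {p' l' : ℕ}, IsLyndonSeq g' p' → p' ≤ l' →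
      F v = ⟨l', seqBlock g' 0 (l' + 1)⟩ → l v = l' ∧ p v = p' ∧ g v = g' := by
    intro v g' p' l' hg' hpl' hF
    simp only [F, Sigma.mk.injEq, heq_eq_eq] at hF
    obtain ⟨rfl, hF⟩ := hF
    have hpv := hpl v
    rcases hg'.period_le_of_seqBlock_eq (hg v) (by omega) (by omega) hF with h₁ | ⟨h₁, h₂, -⟩
    · rcases (hg v).period_le_of_seqBlock_eq hg' (by omega) (by omega) hF.symm with h₃ | ⟨h₃, -⟩
      all_goals omega
    · exact ⟨rfl, h₁, h₂⟩
  have hFinj : Function.Injective F := by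
    intro v v' h
    obtain ⟨h₁, h₂, h₃⟩ := huniq v (hg v') (hpl v') h
    have h₄ := hdiv v
    rw [h₁, h₂, hdiv v'] at h₄
    have h₅ : m v = m v' := by
      have := hm v
      have := hm v'
      omega
    have h₆ : c v = c v' := by
      simp only [l, h₂, h₅] at h₁
      omega
    have h₇ : i v = i v' := by
      simp only [c, h₂, h₃, h₅] at h₆
      refine Nat.count_injective ?_ ?_ h₆
      · rw [← h₂, ← h₃, ← h₅, ← hv]
        exact v.2.1
      · rw [← hv]
        exact v'.2.1
    apply Subtype.ext
    rw [hv, hv, h₂, h₃, h₅, h₇]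
  have hFmem : ∀ v, F v ∈ (Finset.range w.length).sigma (cycleFactors w a) := by
    intro v
    refine hmem (hg v) (hga v) (hpl v) fun x => ?_
    rw [hl]
    refine forall_seqBlock_infix_of_count (hg v).pos (hg v).periodic
      (Nat.le_mul_of_pos_left _ (by have := hm v; omega)) (hi v) ?_ rfl x
    rw [← hv]
    exact v.2.1
  have hSfin : Finite S := Finite.of_injective (fun v => (⟨F v, hFmem v⟩ :
    (Finset.range w.length).sigma (cycleFactors w a))) fun v v' h => hFinj (congrArg Subtype.val h)
  have := Fintype.ofFinite S
  have hSc : S.ncard = (Finset.univ.image F).card := by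
    rw [Finset.card_image_of_injective _ hFinj, Finset.card_univ, ← Nat.card_eq_fintype_card]
    rfl
  have himage : Finset.univ.image F ⊆ (Finset.range w.length).sigma (cycleFactors w a) :=
    Finset.image_subset_iff.2 fun v _ => hFmem v
  rw [← Finset.card_sigma, hSc]
  split_ifs with hcube
  · obtain ⟨u, ⟨x, hxu, hxa⟩, huw⟩ := hcube
    obtain ⟨g', p', i', m', hg', hi', hm', rfl⟩ := exists_isLyndonSeq (List.ne_nil_of_mem hxu)
    obtain ⟨k, -, rfl⟩ := mem_seqBlock.1 hxu
    have hcub : seqBlock g' i' (3 * p') <:+: w := by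
      rw [append_self_seqBlock hg'.periodic,
        ← seqBlock_add_period hg'.periodic (L := m' * p') (2 * m'), ← seqBlock_add] at huw
      exact (seqBlock_infix le_rfl (by nlinarith [hg'.pos])).trans huw
    have hnew := hmem (l := 2 * p') hg' ⟨_, hxa⟩ (by omega) fun x =>
      List.IsInfix.trans (seqBlock_infix le_rfl (by omega))
        (forall_seqBlock_infix_of_count hg'.pos hg'.periodic (by omega) hi' hcub rfl x)
    have hnot : (⟨2 * p', seqBlock g' 0 (2 * p' + 1)⟩ : Σ _ : ℕ, List α) ∉
        Finset.univ.image F := by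
      intro h
      obtain ⟨v, -, h⟩ := Finset.mem_image.1 h
      obtain ⟨h₁, h₂, -⟩ := huniq v hg' (by omega) h
      have h₃ := hdiv v
      rw [h₁, h₂, Nat.mul_div_cancel _ hg'.pos] at h₃
      omega
    rw [← Finset.card_insert_of_notMem hnot]
    exact Finset.card_le_card (Finset.insert_subset hnew himage)
  · exact Finset.card_le_card himage

end CycleFactors

/-! ### Counting squares -/

theorem numSquares_le_add {α : Type*} (w : List α) (a : α) {M : ℕ}
    (hM : ∀ L, List.replicate L a <:+: w → L ≤ M) :
    numSquares w ≤ M / 2 +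
      Set.ncard {v : List α | v <:+: w ∧ (∃ u, u ≠ [] ∧ v = u ++ u) ∧ ∃ x ∈ v, x ≠ a} := by
  classical
  set S := {v : List α | v <:+: w ∧ (∃ u, u ≠ [] ∧ v = u ++ u) ∧ ∃ x ∈ v, x ≠ a}
  set P : Finset (List α) := (Finset.range (M / 2)).image fun d => List.replicate (2 * (d + 1)) a
  have hP : P.card ≤ M / 2 := Finset.card_image_le.trans_eq (Finset.card_range _)
  have hS : S.Finite := (List.finite_toSet w.sublists).subset fun v hv =>
    List.mem_sublists.2 hv.1.sublist
  have hsub : {v : List α | v <:+: w ∧ ∃ u : List α, u ≠ [] ∧ v = u ++ u} ⊆ ↑P ∪ S := by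
    rintro v ⟨hv, u, hu, rfl⟩
    by_cases h : ∃ x ∈ u ++ u, x ≠ a
    · exact Or.inr ⟨hv, ⟨u, hu, rfl⟩, h⟩
    · push Not at h
      have hrep := List.eq_replicate_of_mem h
      have hle := hM _ (hrep ▸ hv)
      have hpos := List.length_pos_of_ne_nil hu
      rw [List.length_append] at hle hrep
      refine Or.inl (Finset.mem_coe.2 (Finset.mem_image.2 ⟨u.length - 1, ?_, ?_⟩))
      · rw [Finset.mem_range]
        omega
      · rw [hrep]
        congr 1
        omega
  calc numSquares w ≤ (↑P ∪ S : Set (List α)).ncard :=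
        Set.ncard_le_ncard hsub (P.finite_toSet.union hS)
    _ ≤ (P : Set (List α)).ncard + S.ncard := Set.ncard_union_le _ _
    _ ≤ M / 2 + S.ncard := by
        rw [Set.ncard_coe_finset]
        omega

/-- If `M` is the length of the longest run of `a`, two disjoint runs of `a` of length `N` occur,
and `c = 1` only if `w` has a cube that is not a power of `a`, then the number of squares satisfies
this bound. -/
theorem numSquares_add_le {α : Type*} [LinearOrder α] {w : List α} {a b : α} (hab : a ≠ b)
    {M N c : ℕ} (hM : List.replicate M a <:+: w) (hMmax : ∀ L, List.replicate L a <:+: w → L ≤ M)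
    (hN : ∃ t, List.replicate N a ++ (b :: t) ++ List.replicate N a <:+: w)
    (hc : c = 0 ∨ c = 1 ∧ ∃ u, (∃ x ∈ u, x ≠ a) ∧ u ++ u ++ u <:+: w) :
    numSquares w + M + N + 1 + c ≤ w.length + M / 2 := by
  have : Inhabited α := ⟨a⟩
  have h₁ := numSquares_le_add w a hMmax
  have h₂ := ncard_squares_add_le w a
  have h₃ := sum_card_cycleFactors_add_le hab hM hN
  rcases hc with rfl | ⟨rfl, hu⟩
  · omega
  · rw [if_pos hu] at h₂
    omega

/-! ### Run lengths of binary words -/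

/-- The word `b a ^ r₀ b a ^ r₁ ⋯ b a ^ rₖ` for a list `r₀, …, rₖ`. -/
def runWord {α : Type*} (a b : α) (R : List ℕ) : List α :=
  R.flatMap fun r => b :: List.replicate r a

section RunWord

variable {α : Type*} {a b : α} {w : List α}

theorem runWord_append (R T : List ℕ) : runWord a b (R ++ T) = runWord a b R ++ runWord a b T := by
  simp [runWord]

theorem runWord_cons (r : ℕ) (R : List ℕ) :
    runWord a b (r :: R) = b :: (List.replicate r a ++ runWord a b R) := by
  simp [runWord]

theorem length_runWord (R : List ℕ) : (runWord a b R).length = R.sum + R.length := by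
  induction R with
  | nil => simp [runWord]
  | cons r R ih =>
    rw [runWord_cons]
    simp [ih]
    omega

theorem exists_runWord_eq (a : Bool) (w : List Bool) :
    ∃ R : List ℕ, (!a) :: w = runWord a (!a) R ∧ R.length = w.count (!a) + 1 := by
  induction w with
  | nil => exact ⟨[0], by simp [runWord], by simp⟩
  | cons x w ih =>
    obtain ⟨R, hR, hlen⟩ := ih
    by_cases hx : x = !a
    · subst hx
      exact ⟨0 :: R, by rw [runWord_cons, ← hR]; simp, by simp [hlen]⟩
    · obtain rfl : x = a := by cases x <;> cases a <;> simp_all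
      cases R with
      | nil => simp at hlen
      | cons r R =>
        rw [runWord_cons, List.cons.injEq] at hR
        refine ⟨(r + 1) :: R, ?_, ?_⟩
        · rw [runWord_cons, hR.2, List.replicate_succ]
          simp
        · simpa [List.count_cons] using hlen

theorem infix_of_cons_infix_cons {x y : α} {v : List α} (h : x :: v <:+: y :: w) : v <:+: w := by
  rcases List.infix_cons_iff.1 h with h | h
  · exact (List.cons_prefix_cons.1 h).2.isInfix
  · exact (List.suffix_cons x v).isInfix.trans h

theorem replicate_infix_of_mem {R : List ℕ} (hw : b :: w = runWord a b R) {r : ℕ} (hr : r ∈ R) :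
    List.replicate r a <:+: w := by
  obtain ⟨A, B, rfl⟩ := List.append_of_mem hr
  refine infix_of_cons_infix_cons (x := b) (y := b) (hw ▸ ⟨runWord a b A, runWord a b B, ?_⟩)
  simp [runWord_append, runWord_cons]

theorem exists_two_runs_infix {A B C : List ℕ} {x y N : ℕ}
    (hw : b :: w = runWord a b (A ++ x :: (B ++ y :: C))) (hx : N ≤ x) (hy : N ≤ y) :
    ∃ t, List.replicate N a ++ (b :: t) ++ List.replicate N a <:+: w := by
  obtain ⟨t, ht⟩ : ∃ t, runWord a b B ++ [b] = b :: t := by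
    cases B with
    | nil => exact ⟨[], rfl⟩
    | cons r B => exact ⟨_, by rw [runWord_cons, List.cons_append]⟩
  obtain ⟨d, rfl⟩ := Nat.exists_eq_add_of_le' hx
  obtain ⟨e, rfl⟩ := Nat.exists_eq_add_of_le hy
  refine ⟨t, List.IsInfix.trans ⟨List.replicate d a, List.replicate e a ++ runWord a b C, ?_⟩
    (infix_of_cons_infix_cons (x := b) (y := b)
      (v := List.replicate (d + N) a ++ runWord a b (B ++ (N + e) :: C))
      (hw ▸ ⟨runWord a b A, [], ?_⟩))⟩
  · rw [← ht]
    simp only [runWord_append, runWord_cons, List.replicate_add, List.append_assoc,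
      List.cons_append, List.nil_append]
  · simp [runWord_append, runWord_cons]

theorem exists_cube_infix_of_three_runs (hab : a ≠ b) {R : List ℕ} {N : ℕ}
    (hw : b :: w = runWord a b R) (hR : 4 ≤ R.length) (h : [N, N, N] <:+: R) :
    ∃ u, (∃ x ∈ u, x ≠ a) ∧ u ++ u ++ u <:+: w := by
  obtain ⟨A, B, rfl⟩ := h
  cases B with
  | cons r B =>
    refine ⟨List.replicate N a ++ [b], ⟨b, by simp, hab.symm⟩, ?_⟩
    refine infix_of_cons_infix_cons (x := b) (y := b)
      (hw ▸ ⟨runWord a b A, List.replicate r a ++ runWord a b B, ?_⟩)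
    simp [runWord_append, runWord_cons]
  | nil =>
    cases A with
    | nil => simp at hR
    | cons r A =>
      refine ⟨b :: List.replicate N a, ⟨b, by simp, hab.symm⟩, ?_⟩
      simp only [runWord_append, runWord_cons, List.cons_append, List.append_assoc,
        List.cons.injEq, true_and] at hw
      rw [hw]
      exact ⟨List.replicate r a ++ runWord a b A, [], by simp [runWord]⟩

end RunWord

theorem sum_add_sum_map_sub {N : ℕ} (L : List ℕ) (hL : ∀ r ∈ L, r ≤ N) :
    L.sum + (L.map (N - ·)).sum = L.length * N := by
  induction L with
  | nil => simp
  | cons r L ih =>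
    have h₁ := ih fun x hx => hL x (List.mem_cons_of_mem _ hx)
    have h₂ := hL r List.mem_cons_self
    simp only [List.sum_cons, List.map_cons, List.length_cons, Nat.add_mul, Nat.one_mul]
    omega

/-- A list bounded by `N` with few deviations from `N` has three consecutive entries `N`. -/
theorem length_le_of_not_three_infix {N : ℕ} :
    ∀ L : List ℕ, (∀ r ∈ L, r ≤ N) → ¬ [N, N, N] <:+: L →
      L.length ≤ 3 * (L.map (N - ·)).sum + 2
  | [], _, _ => by simp
  | [_], _, _ => by simp
  | [_, _], _, _ => by simp
  | x :: y :: z :: L, hL, h => by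
    have ih := length_le_of_not_three_infix L (fun r hr => hL r (by simp [hr])) fun h' =>
      h (h'.trans ⟨[x, y, z], [], by simp⟩)
    have hx := hL x (by simp)
    have hy := hL y (by simp)
    have hz := hL z (by simp)
    have hne : ¬ (x = N ∧ y = N ∧ z = N) := by
      rintro ⟨rfl, rfl, rfl⟩
      exact h ⟨[], L, by simp⟩
    simp only [List.map_cons, List.sum_cons, List.length_cons]
    omega

/-- The Jonoska–Manea–Seki bound in terms of the number `k ≥ 2` of occurrences of a letter. -/
theorem numSquares_mul_le (a : Bool) (w : List Bool) {k : ℕ} (hk : k = w.count (!a))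
    (hk2 : 2 ≤ k) : numSquares w * (2 * k + 2) + w.length ≤ 2 * k * w.length := by
  have hab : a ≠ !a := by simp
  obtain ⟨R, hw, hlen⟩ := exists_runWord_eq a w
  rw [← hk] at hlen
  have hn := congrArg List.length hw
  rw [length_runWord, List.length_cons, hlen] at hn
  obtain ⟨m, hmR, hm⟩ := R.toFinset.exists_max_image id
    (List.toFinset_nonempty_iff _ |>.2 (List.ne_nil_of_length_pos (by omega)))
  simp only [List.mem_toFinset, id] at hmR hm
  obtain ⟨A, B, rfl⟩ := List.append_of_mem hmR
  obtain ⟨N, hNAB, hN⟩ := (A ++ B).toFinset.exists_max_image id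
    (List.toFinset_nonempty_iff _ |>.2 (List.ne_nil_of_length_pos (by simp at hlen ⊢; omega)))
  simp only [List.mem_toFinset, id] at hNAB hN
  have hNm : N ≤ m := hm N (by
    rcases List.mem_append.1 hNAB with h | h <;> simp [h])
  have hN2 : ∃ t, List.replicate N a ++ ((!a) :: t) ++ List.replicate N a <:+: w := by
    rcases List.mem_append.1 hNAB with h | h
    · obtain ⟨A₁, A₂, rfl⟩ := List.append_of_mem h
      exact exists_two_runs_infix (A := A₁) (B := A₂) (C := B) (by rw [hw]; simp) le_rfl hNm
    · obtain ⟨B₁, B₂, rfl⟩ := List.append_of_mem h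
      exact exists_two_runs_infix hw hNm le_rfl
  have hfin : ∃ M, List.replicate M a <:+: w ∧ ∀ L, List.replicate L a <:+: w → L ≤ M := by
    classical
    refine ⟨Nat.findGreatest (fun L => List.replicate L a <:+: w) w.length,
      Nat.findGreatest_spec (P := fun L => List.replicate L a <:+: w) (Nat.zero_le _) (by simp),
      fun L hL => Nat.le_findGreatest (by simpa using hL.length_le) hL⟩
  obtain ⟨M, hM, hMmax⟩ := hfin
  have hmM : m ≤ M := hMmax m (replicate_infix_of_mem hw hmR)
  have hsum := sum_add_sum_map_sub (A ++ B) hN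
  have hlenAB : (A ++ B).length = k := by
    simp at hlen ⊢
    omega
  rw [hlenAB] at hsum
  have hsumR : (A ++ m :: B).sum = m + (A ++ B).sum := by
    simp
    omega
  rw [hsumR] at hn
  generalize hD : ((A ++ B).map (N - ·)).sum = D at hsum
  generalize (A ++ B).sum = σ at hn hsum
  by_cases hcase : m = N ∧ m % 2 = 0 ∧ 3 * D + 3 ≤ k
  · obtain ⟨rfl, heven, hDk⟩ := hcase
    have hthree : [m, m, m] <:+: A ++ m :: B := by
      by_contra h
      have h₁ := length_le_of_not_three_infix _ hm h
      have h₂ : ((A ++ m :: B).map (m - ·)).sum = D := by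
        rw [← hD]
        simp
      rw [h₂, hlen] at h₁
      omega
    have h := numSquares_add_le hab hM hMmax hN2 (c := 1)
      (Or.inr ⟨rfl, exists_cube_infix_of_three_runs hab hw (by omega) hthree⟩)
    obtain ⟨q, rfl⟩ : ∃ q, m = 2 * q := ⟨m / 2, by omega⟩
    have h' : numSquares w + 3 * q + 2 ≤ w.length := by omega
    have hn' : w.length + D = 2 * q + k * (2 * q) + k := by omega
    nlinarith
  · have h := numSquares_add_le hab hM hMmax hN2 (c := 0) (Or.inl rfl)
    obtain ⟨δ, rfl⟩ := Nat.exists_eq_add_of_le hNm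
    have hn' : w.length + D = N + δ + k * N + k := by omega
    obtain ⟨q, e, he, hq⟩ : ∃ q e, e < 2 ∧ N + δ = 2 * q + e :=
      ⟨(N + δ) / 2, (N + δ) % 2, Nat.mod_lt _ two_pos, (Nat.div_add_mod _ _).symm⟩
    have h' : numSquares w + q + e + N + 1 ≤ w.length := by omega
    have hcases : 1 ≤ δ ∨ e = 1 ∨ k ≤ 3 * D + 2 := by omega
    have hkey : k ≤ 3 * D + 2 + (k - 2) * δ + (k + 1) * e := by
      rcases hcases with h | rfl | h
      · have := Nat.mul_le_mul_left (k - 2) h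
        omega
      · omega
      · omega
    obtain ⟨k, rfl⟩ := Nat.exists_eq_add_of_le' hk2
    simp only [Nat.add_sub_cancel] at hkey
    nlinarith

theorem square_count_bound_binary_small_k
    (w : List Bool) (k : ℕ)
    (hk : k = min (w.count false) (w.count true)) (hk2 : 2 ≤ k) (hk9 : k ≤ 9) :
    (numSquares w : ℚ) ≤ (2 * k - 1) / (2 * k + 2) * w.length := by
  have h : numSquares w * (2 * k + 2) + w.length ≤ 2 * k * w.length := by
    rcases min_choice (w.count false) (w.count true) with h | h
    · exact numSquares_mul_le true w (hk.trans h) hk2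
    · exact numSquares_mul_le false w (hk.trans h) hk2
  have h' : (numSquares w : ℚ) * (2 * k + 2) + w.length ≤ 2 * k * w.length := by exact_mod_cast h
  rw [div_mul_eq_mul_div, le_div_iff₀ (by positivity)]
  linarith
end

section
/- Let w be a finite word over the alphabet {a,b}. Define S_w to be the set of integers i with 1 ≤ i ≤ |w| for which there exists a nonempty word z over {a,b} whose first letter is b, such that a^i is a suffix of the word a^i z and every length-(i+1) factor of a^i z is a factor of w. Let I_w be the cardinality of S_w. Then m(w) + I_w ≤ |w| − |Alph(w)|. -/
open Finset

/-- The factor of length `m` starting at position `s` of the infinite word `f`. -/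
def window {α : Type*} (f : ℕ → α) (s m : ℕ) : List α := (List.range m).map fun k => f (s + k)

section Window

variable {α : Type*} (f g : ℕ → α) (s t m n : ℕ)

@[simp] theorem length_window : (window f s m).length = m := by simp [window]

theorem window_eq_iff : window f s m = window g t m ↔ ∀ k < m, f (s + k) = g (t + k) := by
  simp [window]

theorem window_add : window f s (m + n) = window f s m ++ window f (s + m) n := by
  simp [window, List.range_add, Function.comp_def, add_assoc]

theorem take_window_succ : (window f s (m + 1)).take m = window f s m := by
  rw [window_add, List.take_left' (length_window f s m)]

theorem tail_window_succ : (window f s (m + 1)).tail = window f (s + 1) m := by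
  rw [add_comm m 1, window_add]
  simp [window]

theorem window_infix_left : window f s m <:+: window f s (m + 1) :=
  ⟨[], window f (s + m) 1, by rw [window_add]; simp⟩

theorem window_infix_right : window f (s + 1) m <:+: window f s (m + 1) :=
  ⟨window f s 1, [], by rw [add_comm m 1, window_add]; simp⟩

variable {f}

theorem Function.Periodic.window {p : ℕ} (hf : Function.Periodic f p) :
    window f (s + p) m = window f s m := by
  rw [window_eq_iff]
  intro k _
  rw [add_right_comm]
  exact hf _

theorem Function.Periodic.window_mod {p : ℕ} (hf : Function.Periodic f p) :
    _root_.window f (s % p) m = _root_.window f s m := by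
  rw [window_eq_iff]
  intro k _
  rw [← hf.map_mod_nat, ← hf.map_mod_nat (s + k), Nat.mod_add_mod]

end Window

theorem take_drop_infix {α : Type*} (w : List α) (s m : ℕ) : (w.drop s).take m <:+: w :=
  ⟨w.take s, (w.drop s).drop m, by
    rw [List.append_assoc, List.take_append_drop, List.take_append_drop]⟩

theorem take_drop_eq_window {α : Type*} (w : List α) (d : α) {s m : ℕ} (h : s + m ≤ w.length) :
    (w.drop s).take m = window (fun k => w.getD k d) s m := by
  apply List.ext_getElem
  · simp; omega
  · intro k hk _
    simp at hk
    simp [window, List.getD_eq_getElem?_getD,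
      List.getElem?_eq_getElem (show s + k < w.length by omega)]

theorem isInfix_iff_window {α : Type*} (w v : List α) (d : α) :
    v <:+: w ↔ ∃ s, s + v.length ≤ w.length ∧ v = window (fun k => w.getD k d) s v.length := by
  constructor
  · rintro ⟨a, b, rfl⟩
    refine ⟨a.length, by simp, ?_⟩
    rw [← take_drop_eq_window _ _ (by simp)]
    simp
  · rintro ⟨s, hs, h⟩
    rw [← take_drop_eq_window _ _ hs] at h
    rw [h]
    exact take_drop_infix _ _ _

theorem append_le_append_iff {α : Type*} [LinearOrder α] {a b : List α}
    (h : a.length = b.length) (c d : List α) :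
    a ++ c ≤ b ++ d ↔ a < b ∨ a = b ∧ c ≤ d := by
  induction a generalizing b with
  | nil =>
    obtain rfl : b = [] := by simpa [eq_comm] using h
    simp
  | cons x a ih =>
    obtain _ | ⟨y, b⟩ := b
    · simp at h
    · have := ih (b := b) (by simpa using h)
      simp only [← not_lt, List.cons_append, List.cons_lt_cons_iff, List.cons.injEq] at this ⊢
      rcases lt_trichotomy x y with hxy | rfl | hxy
      · simp [hxy, hxy.not_gt, hxy.ne']
      · simpa using this
      · simp [hxy, hxy.not_gt, hxy.ne']

/-- If the differences of a potential along the edges in `X` determine it up to a constant on `V`,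
then `#V ≤ #X + 1`. -/
theorem card_le_card_add_one_of_connected {α β : Type*} [DecidableEq α] (V : Finset α)
    (X : Finset β) (t h : β → α) (v₀ : α)
    (H : ∀ g : α → ℚ, (∀ e ∈ X, g (t e) = g (h e)) → ∀ v ∈ V, g v = g v₀) :
    #V ≤ #X + 1 := by
  classical
  let ext : (V → ℚ) →ₗ[ℚ] (α → ℚ) :=
    { toFun := fun g a => if ha : a ∈ V then g ⟨a, ha⟩ else 0
      map_add' := by intro a b; ext x; by_cases hx : x ∈ V <;> simp [hx]
      map_smul' := by intro a b; ext x; by_cases hx : x ∈ V <;> simp [hx] }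
  let φ : (V → ℚ) →ₗ[ℚ] (X → ℚ) × ℚ :=
    { toFun := fun g => (fun e => ext g (t e) - ext g (h e), ext g v₀)
      map_add' := by intro a b; ext x <;> simp; ring
      map_smul' := by intro a b; ext x <;> simp; ring }
  have hφ : Function.Injective φ := by
    rw [← LinearMap.ker_eq_bot, LinearMap.ker_eq_bot']
    intro g hg
    have h1 : ∀ e ∈ X, ext g (t e) = ext g (h e) := fun e he =>
      sub_eq_zero.1 (congrFun (congrArg Prod.fst hg) ⟨e, he⟩)
    have h2 : ext g v₀ = 0 := congrArg Prod.snd hg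
    ext ⟨v, hv⟩
    have h3 := H _ h1 v hv
    rw [h2] at h3
    simpa [ext, hv] using h3
  simpa using LinearMap.finrank_le_finrank_of_injective hφ

/-- Closed walk in which the first edge is the only one not known to preserve the potential. -/
theorem potential_eq_of_closed_walk {α β : Type*} (g : List α → β) (f : ℕ → α) (i t : ℕ)
    (ht : 0 < t) (hclosed : window f t i = window f 0 i)
    (hedge : ∀ s < t, window f s (i + 1) ≠ window f 0 (i + 1) →
      g (window f s i) = g (window f (s + 1) i)) :
    g (window f 0 i) = g (window f 1 i) := by
  classical
  have hex : ∃ t, 0 < t ∧ window f t i = window f 0 i := ⟨t, ht, hclosed⟩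
  obtain ⟨hpos, heq⟩ := Nat.find_spec hex
  have hle : Nat.find hex ≤ t := Nat.find_min' hex ⟨ht, hclosed⟩
  have key : ∀ s, s + 1 ≤ Nat.find hex → g (window f (s + 1) i) = g (window f 1 i) := by
    intro s hs
    induction s with
    | zero => rfl
    | succ s ih =>
      rw [← ih (by omega)]
      refine (hedge (s + 1) (by omega) fun h => ?_).symm
      refine Nat.find_min hex (m := s + 1) (by omega) ⟨by omega, ?_⟩
      rw [← take_window_succ, h, take_window_succ]
  have := key (Nat.find hex - 1) (by omega)
  rwa [Nat.sub_add_cancel hpos, heq] at this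

theorem card_filter_range_le_card_filter_Ioc (Q : ℕ → ℕ → Prop) [∀ m, DecidablePred (Q m)]
    [DecidablePred fun m => ∀ s, Q m s] {p L : ℕ} (hp : 0 < p)
    (hleft : ∀ m s, Q (m + 1) s → Q m s) (hright : ∀ m s, Q (m + 1) s → Q m (s + 1))
    (hmod : ∀ m s, Q m (s % p) ↔ Q m s) (hL : p ≤ L) :
    #{s ∈ range p | Q L s} ≤ #{m ∈ Ioc (L - p) L | ∀ s, Q m s} := by
  set A : ℕ → Finset ℕ := fun m => {s ∈ range p | Q m s} with hA
  have hmemA : ∀ m s, s ∈ A m ↔ s < p ∧ Q m s := by simp [hA]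
  have hfull : ∀ m, p ≤ #(A m) → ∀ s, Q m s := by
    intro m h s
    have : A m = range p := eq_of_subset_of_card_le (filter_subset _ _) (by simpa using h)
    have hs : s % p ∈ A m := by rw [this]; simpa using Nat.mod_lt _ hp
    exact (hmod m s).1 ((hmemA _ _).1 hs).2
  rcases Nat.eq_zero_or_pos #(A L) with h0 | hpos
  · exact h0.trans_le (Nat.zero_le _)
  have hstep : ∀ m, 0 < #(A (m + 1)) → min p (#(A (m + 1)) + 1) ≤ #(A m) := by
    intro m hm
    have hsub : A (m + 1) ⊆ A m := fun s hs => by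
      rw [hmemA] at hs ⊢; exact ⟨hs.1, hleft _ _ hs.2⟩
    by_contra! hlt
    have heq : A (m + 1) = A m := eq_of_subset_of_card_le hsub (by omega)
    obtain ⟨s₀, hs₀⟩ := card_pos.1 hm
    have hclos : ∀ s, Q m s → Q m (s + 1) := by
      intro s hs
      have : s % p ∈ A m := (hmemA _ _).2 ⟨Nat.mod_lt _ hp, (hmod _ _).2 hs⟩
      rw [← heq, hmemA, hmod] at this
      exact hright _ _ this.2
    have hall : ∀ k, Q m (s₀ + k) := by
      intro k
      induction k with
      | zero => rw [heq, hmemA] at hs₀; exact hs₀.2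
      | succ k ih => exact hclos _ ih
    have : A m = range p := by
      refine filter_true_of_mem fun s _ => ?_
      have h1 := hall (s + p * s₀ - s₀)
      have h2 : s₀ + (s + p * s₀ - s₀) = s + p * s₀ := by
        have := Nat.le_mul_of_pos_left s₀ hp
        omega
      rwa [h2, ← hmod, Nat.add_mul_mod_self_left, hmod] at h1
    rw [this] at hlt
    simp at hlt
  have hgrow : ∀ t ≤ L, min p (#(A L) + t) ≤ #(A (L - t)) := by
    intro t ht
    induction t with
    | zero => simp
    | succ t ih =>
      have h1 := ih (by omega)
      have h2 := hstep (L - (t + 1))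
      rw [show L - (t + 1) + 1 = L - t by omega] at h2
      have := h2 (by omega)
      omega
  have hcard : #(A L) ≤ p := by simpa using card_filter_le (range p) (Q L)
  calc #(A L) = #(Ioc (L - p) (L - p + #(A L))) := by simp
    _ ≤ _ := by
      refine card_le_card fun m hm => ?_
      rw [mem_Ioc] at hm
      rw [mem_filter, mem_Ioc]
      refine ⟨by omega, hfull m ?_⟩
      have := hgrow (L - m) (by omega)
      rw [show L - (L - m) = m by omega] at this
      omega

section Lyndon

variable {α : Type*} [LinearOrder α]

/-- `f` is the purely periodic word with least period `p` that is the largest, for the lexicographic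
order, among its own shifts. -/
structure IsLyndonWord (f : ℕ → α) (p : ℕ) : Prop where
  pos : 0 < p
  periodic : Function.Periodic f p
  minimal : ∀ q, 0 < q → Function.Periodic f q → p ≤ q
  maximal : ∀ s, window f s p ≤ window f 0 p

namespace IsLyndonWord

variable {f g : ℕ → α} {p q : ℕ}

theorem window_le (hf : IsLyndonWord f p) (s m : ℕ) : window f s m ≤ window f 0 m := by
  have hmax := hf.maximal s
  rcases le_total m p with h | h
  · obtain ⟨k, rfl⟩ := Nat.exists_eq_add_of_le h
    rw [window_add, window_add, append_le_append_iff (by simp)] at hmax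
    rcases hmax with h | h
    exacts [h.le, h.1.le]
  · rcases hmax.lt_or_eq with hlt | heq
    · obtain ⟨k, rfl⟩ := Nat.exists_eq_add_of_le h
      rw [window_add, window_add, append_le_append_iff (by simp)]
      exact Or.inl hlt
    · apply le_of_eq
      rw [window_eq_iff] at heq ⊢
      intro k _
      have := heq (k % p) (Nat.mod_lt _ hf.pos)
      rw [← hf.periodic.map_mod_nat, Nat.add_mod_mod, hf.periodic.map_mod_nat, zero_add,
        hf.periodic.map_mod_nat] at this
      simpa using this

theorem unbordered (hf : IsLyndonWord f p) (hq : 0 < q) (hqp : q < p)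
    (h : ∀ k < p - q, f (k + q) = f k) : False := by
  obtain ⟨r, rfl⟩ := Nat.exists_eq_add_of_le' hqp.le
  simp only [Nat.add_sub_cancel] at h
  have hmax := hf.maximal q
  have hy : window f q r = window f 0 r := by
    rw [window_eq_iff]
    intro k hk
    rw [zero_add, add_comm, h k hk]
  have hz : window f (q + r) q = window f 0 q := by
    rw [add_comm q r, ← hf.periodic.window 0 q, zero_add]
  rw [window_add, window_add f 0, append_le_append_iff (by simp), hy, hz, zero_add] at hmax
  have hle : window f 0 q ≤ window f r q := by
    rcases hmax with hmax | hmax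
    exacts [(lt_irrefl _ hmax).elim, hmax.2]
  have heq := (window_eq_iff _ _ _ _ _).1 (hle.antisymm (hf.window_le r q))
  have hper : ∀ n < r + q, f (n + r) = f n := by
    intro n hn
    rcases lt_or_ge n q with hnq | hnq
    · rw [add_comm, ← heq n hnq, zero_add]
    · obtain ⟨k, rfl⟩ := Nat.exists_eq_add_of_le' hnq
      rw [h k (by omega), add_assoc, add_comm q r, hf.periodic]
  have hr : Function.Periodic f r := by
    intro n
    have := hper (n % (r + q)) (Nat.mod_lt _ hf.pos)
    rwa [← hf.periodic.map_mod_nat, Nat.mod_add_mod, hf.periodic.map_mod_nat,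
      hf.periodic.map_mod_nat] at this
  have := hf.minimal r (by omega) hr
  omega

theorem not_lt_of_window_eq (hf : IsLyndonWord f p) (hg : IsLyndonWord g q) {m : ℕ}
    (hm : q ≤ m) (h : window f 0 m = window g 0 m) : ¬ p < q := by
  intro hpq
  simp only [window_eq_iff, zero_add] at h
  refine hg.unbordered hf.pos hpq fun k hk => ?_
  rw [← h _ (by omega), ← h _ (by omega), hf.periodic]

theorem eq_of_window_eq (hf : IsLyndonWord f p) (hg : IsLyndonWord g q) {m : ℕ}
    (hpm : p ≤ m) (hqm : q ≤ m) (h : window f 0 m = window g 0 m) : p = q ∧ f = g := by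
  obtain rfl : p = q := le_antisymm (not_lt.1 (hg.not_lt_of_window_eq hf hpm h.symm))
    (not_lt.1 (hf.not_lt_of_window_eq hg hqm h))
  refine ⟨rfl, funext fun n => ?_⟩
  simp only [window_eq_iff, zero_add] at h
  rw [← hf.periodic.map_mod_nat, ← hg.periodic.map_mod_nat]
  exact h _ ((Nat.mod_lt _ hf.pos).trans_le hpm)

theorem exists_shift {f₀ : ℕ → α} {c : ℕ} (hc : 0 < c) (hf₀ : Function.Periodic f₀ c) :
    ∃ f p s, IsLyndonWord f p ∧ p ∣ c ∧ s < p ∧ ∀ k, f₀ k = f (s + k) := by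
  classical
  have hex : ∃ p, 0 < p ∧ Function.Periodic f₀ p := ⟨c, hc, hf₀⟩
  obtain ⟨p, ⟨hp, hper⟩, hmin⟩ : ∃ p, (0 < p ∧ Function.Periodic f₀ p) ∧
      ∀ q, 0 < q → Function.Periodic f₀ q → p ≤ q :=
    ⟨_, Nat.find_spec hex, fun q hq hq' => Nat.find_min' hex ⟨hq, hq'⟩⟩
  obtain ⟨s, hs, hmax⟩ := exists_max_image (range p) (fun s => window f₀ s p) ⟨0, by simpa⟩
  rw [mem_range] at hs
  have hback : ∀ n, f₀ n = f₀ (n + (p - s) + s) := fun n => by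
    rw [add_assoc, Nat.sub_add_cancel hs.le, hper]
  have hshift : ∀ a m, window (fun n => f₀ (n + s)) a m = window f₀ (a + s) m := fun a m => by
    rw [window_eq_iff]
    intro k _
    rw [add_right_comm]
  have hfper : Function.Periodic (fun n => f₀ (n + s)) p := fun n => by
    simp only [add_right_comm n p s, hper _]
  refine ⟨fun n => f₀ (n + s), p, (p - s) % p, ⟨hp, hfper, ?_, ?_⟩, ?_, Nat.mod_lt _ hp, ?_⟩
  · intro q hq hq'
    refine hmin q hq fun n => ?_
    rw [hback, hback n, add_right_comm n q]
    exact hq' _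
  · intro a
    rw [hshift, hshift, zero_add, ← hper.window_mod]
    exact hmax _ (mem_range.2 (Nat.mod_lt _ hp))
  · rw [Nat.dvd_iff_mod_eq_zero]
    by_contra hne
    refine (hmin _ (Nat.pos_of_ne_zero hne) fun n => ?_).not_gt (Nat.mod_lt c hp)
    rw [← hper.map_mod_nat, Nat.add_mod_mod, hper.map_mod_nat, hf₀]
  · intro k
    set f : ℕ → α := fun n => f₀ (n + s) with hf
    calc f₀ k = f (p - s + k) := by rw [hback, add_comm k]
      _ = f ((p - s + k) % p) := (hfper.map_mod_nat _).symm
      _ = f (((p - s) % p + k) % p) := by rw [Nat.mod_add_mod]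
      _ = f ((p - s) % p + k) := hfper.map_mod_nat _

end IsLyndonWord

theorem exists_isLyndonWord_of_power {u : List α} (hu : u ≠ []) {j : ℕ} (hj : 2 ≤ j) :
    ∃ f p s, IsLyndonWord f p ∧ p ∣ (List.replicate j u).flatten.length ∧
      2 * p ≤ (List.replicate j u).flatten.length ∧ s < p ∧
      (List.replicate j u).flatten = window f s (List.replicate j u).flatten.length := by
  have hpos : 0 < u.length := List.length_pos_iff.2 hu
  set f₀ : ℕ → α := fun n => u[n % u.length]'(Nat.mod_lt _ hpos) with hf₀
  have hper : Function.Periodic f₀ u.length := fun n => by simp [hf₀]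
  have hu₀ : u = window f₀ 0 u.length := by
    apply List.ext_getElem
    · simp
    · intro k hk _
      simp [window, hf₀, Nat.mod_eq_of_lt hk]
  have hpow : ∀ j, (List.replicate j u).flatten = window f₀ 0 (j * u.length) := by
    intro j
    induction j with
    | zero => simp [window]
    | succ j ih =>
      rw [List.replicate_succ, List.flatten_cons, ih, add_mul, one_mul, add_comm, window_add, ← hu₀,
        hper.window]
  obtain ⟨f, p, s, hf, hdvd, hs, hfs⟩ := IsLyndonWord.exists_shift hpos hper
  refine ⟨f, p, s, hf, ?_, ?_, hs, ?_⟩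
  · simpa using hdvd.mul_left j
  · simpa using Nat.mul_le_mul hj (Nat.le_of_dvd hpos hdvd)
  · rw [hpow, length_window, window_eq_iff]
    intro k _
    rw [zero_add, hfs]

end Lyndon

section Rauzy

variable {α : Type*} [LinearOrder α]

/-- The finset of factors of length `m` of `w`. -/
def factors (w : List α) (m : ℕ) : Finset (List α) :=
  (range (w.length + 1 - m)).image fun s => (w.drop s).take m

theorem mem_factors {w v : List α} {m : ℕ} : v ∈ factors w m ↔ v <:+: w ∧ v.length = m := by
  simp only [factors, mem_image, mem_range]
  constructor
  · rintro ⟨s, hs, rfl⟩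
    refine ⟨take_drop_infix _ _ _, ?_⟩
    simp
    omega
  · rintro ⟨⟨a, b, rfl⟩, rfl⟩
    exact ⟨a.length, by simp; omega, by simp⟩

open Classical in
/-- The lexicographically largest edges of the circuits of length at most `i` in the `i`-th Rauzy
graph of `w`. -/
noncomputable def maxCircuitEdges (w : List α) (i : ℕ) : Finset (List α) :=
  {e ∈ factors w (i + 1) | ∃ f p, 0 < p ∧ p ≤ i ∧ Function.Periodic f p ∧
    e = window f 0 (i + 1) ∧ ∀ s, window f s (i + 1) <:+: w ∧ window f s (i + 1) ≤ e}

theorem numPowers_le_sum_card_maxCircuitEdges [Nonempty α] (w : List α) :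
    numPowers w ≤ ∑ i ∈ Ico 1 w.length, #(maxCircuitEdges w i) := by
  classical
  let S := {v : List α | v <:+: w ∧
    ∃ u : List α, u ≠ [] ∧ ∃ j : ℕ, 2 ≤ j ∧ v = (List.replicate j u).flatten}
  have hfin : S.Finite := by
    refine ((range (w.length + 1)).biUnion (factors w)).finite_toSet.subset fun v hv => ?_
    simp only [coe_biUnion, Set.mem_iUnion, mem_coe, mem_range]
    exact ⟨v.length, Nat.lt_succ_of_le hv.1.length_le, mem_factors.2 ⟨hv.1, rfl⟩⟩
  have hex : ∀ v : List α, ∃ f p s, v ∈ S → IsLyndonWord f p ∧ p ∣ v.length ∧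
      2 * p ≤ v.length ∧ s < p ∧ v = window f s v.length := by
    intro v
    by_cases hv : v ∈ S
    · obtain ⟨-, u, hu, j, hj, rfl⟩ := hv
      obtain ⟨f, p, s, h⟩ := exists_isLyndonWord_of_power hu hj
      exact ⟨f, p, s, fun _ => h⟩
    · exact ⟨fun _ => Classical.arbitrary α, 0, 0, fun h => absurd h hv⟩
  choose f p s hkey using hex
  let key : List α → (ℕ → α) × ℕ × ℕ := fun v => (f v, p v, v.length)
  let levels : (ℕ → α) × ℕ × ℕ → Finset ℕ := fun c =>
    {m ∈ Ioc (c.2.2 - c.2.1) c.2.2 | ∀ s, window c.1 s m <:+: w}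
  let B : (ℕ → α) × ℕ × ℕ → Finset (List α) := fun c => (levels c).image (window c.1 0)
  have hB : ∀ c, #(B c) = #(levels c) := fun c =>
    card_image_of_injective _ fun m n h => by simpa using congrArg List.length h
  have hS' : ∀ v, v ∈ hfin.toFinset ↔ v ∈ S := fun v => hfin.mem_toFinset
  rw [numPowers, Set.ncard_eq_toFinset_card _ hfin]
  calc #hfin.toFinset
      = ∑ c ∈ hfin.toFinset.image key, #{v ∈ hfin.toFinset | key v = c} :=
        card_eq_sum_card_image _ _
    _ ≤ ∑ c ∈ hfin.toFinset.image key, #(B c) := by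
        refine sum_le_sum fun c hc => ?_
        obtain ⟨v, hv, rfl⟩ := mem_image.1 hc
        obtain ⟨hL, -, h2, -, -⟩ := hkey v ((hS' v).1 hv)
        rw [hB]
        refine le_trans ?_ (card_filter_range_le_card_filter_Ioc
          (fun m s => window (f v) s m <:+: w) hL.pos
          (fun m s h => (window_infix_left _ _ _).trans h)
          (fun m s h => (window_infix_right _ _ _).trans h)
          (fun m s => by rw [hL.periodic.window_mod]) (by simp only [key]; omega))
        refine (card_le_card fun x hx => ?_).trans
          (card_image_le (f := fun s => window (f v) s v.length))
        rw [mem_filter, hS'] at hx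
        obtain ⟨hxS, hxk⟩ := hx
        simp only [key, Prod.mk.injEq] at hxk
        obtain ⟨hxf, hxp, hxl⟩ := hxk
        obtain ⟨-, -, -, hsx, hxw⟩ := hkey x hxS
        rw [hxf, hxl] at hxw
        rw [mem_image]
        refine ⟨s x, ?_, hxw.symm⟩
        rw [mem_filter, mem_range, ← hxw]
        change s x < p v ∧ _
        rw [← hxp]
        exact ⟨hsx, hxS.1⟩
    _ = #((hfin.toFinset.image key).biUnion B) := by
        refine (card_biUnion fun c hc d hd hcd => disjoint_left.2 fun e hec hed => hcd ?_).symm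
        obtain ⟨x, hx, rfl⟩ := mem_image.1 hc
        obtain ⟨y, hy, rfl⟩ := mem_image.1 hd
        obtain ⟨hLx, hdx, h2x, -, -⟩ := hkey x ((hS' x).1 hx)
        obtain ⟨hLy, hdy, h2y, -, -⟩ := hkey y ((hS' y).1 hy)
        obtain ⟨m, hm, rfl⟩ := mem_image.1 hec
        obtain ⟨n, hn, hmn⟩ := mem_image.1 hed
        obtain rfl : n = m := by simpa using congrArg List.length hmn
        simp only [levels, key, mem_filter, mem_Ioc] at hm hn hmn
        obtain ⟨hp, hf⟩ := hLx.eq_of_window_eq hLy (by omega) (by omega) hmn.symm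
        simp only [key, Prod.mk.injEq]
        refine ⟨hf, hp, ?_⟩
        rw [← hp] at hdy hn
        obtain ⟨a, ha⟩ := hdx
        obtain ⟨b, hb⟩ := hdy
        have h1 : p x * a < p x * (b + 1) := by rw [mul_add]; omega
        have h2 : p x * b < p x * (a + 1) := by rw [mul_add]; omega
        have h1 := lt_of_mul_lt_mul_left' h1
        have h2 := lt_of_mul_lt_mul_left' h2
        rw [ha, hb, show a = b by omega]
    _ ≤ #((Ico 1 w.length).biUnion (maxCircuitEdges w)) := by
        refine card_le_card fun e he => ?_
        obtain ⟨c, hc, he⟩ := mem_biUnion.1 he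
        obtain ⟨v, hv, rfl⟩ := mem_image.1 hc
        obtain ⟨hL, -, h2, -, -⟩ := hkey v ((hS' v).1 hv)
        obtain ⟨m, hm, rfl⟩ := mem_image.1 he
        simp only [levels, key, mem_filter, mem_Ioc] at hm
        obtain ⟨i, rfl⟩ : ∃ i, m = i + 1 := ⟨m - 1, by omega⟩
        have hlen := (hm.2 0).length_le
        have hpos := hL.pos
        rw [length_window] at hlen
        rw [mem_biUnion]
        refine ⟨i, mem_Ico.2 ⟨by omega, by omega⟩, mem_filter.2
          ⟨mem_factors.2 ⟨hm.2 0, length_window _ _ _⟩, f v, p v, hpos, by omega, hL.periodic, rfl,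
            fun s => ⟨hm.2 s, hL.window_le s _⟩⟩⟩
    _ ≤ _ := card_biUnion_le

end Rauzy

section SpecialCircuit

/-- The orders `i` for which some circuit of the `i`-th Rauzy graph of `w` passes through the edge
`a^i b`. -/
def specialOrders (w : List Bool) : Set ℕ :=
  {i : ℕ | 1 ≤ i ∧ i ≤ w.length ∧
    ∃ z : List Bool, z ≠ [] ∧ z.head? = some true ∧
      List.replicate i false <:+ (List.replicate i false ++ z) ∧
      ∀ v : List Bool, v.length = i + 1 →
        v <:+: (List.replicate i false ++ z) → v <:+: w}

/-- A closed walk witnessing `i ∈ specialOrders w`, as the windows of an infinite word. -/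
theorem exists_closed_walk_of_mem_specialOrders {w : List Bool} {i : ℕ}
    (hi : i ∈ specialOrders w) :
    ∃ f t, 0 < t ∧ window f 0 (i + 1) = List.replicate i false ++ [true] ∧
      window f t i = window f 0 i ∧ ∀ s < t, window f s (i + 1) <:+: w := by
  obtain ⟨-, -, z, -, hz, hsuf, hfac⟩ := hi
  obtain ⟨z, rfl⟩ : ∃ z', z = true :: z' := by
    cases z with
    | nil => simp at hz
    | cons x z => exact ⟨z, by simpa using hz⟩
  set y := List.replicate i false ++ true :: z with hy
  have hlen : y.length = i + (z.length + 1) := by simp [hy]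
  refine ⟨fun k => y.getD k false, z.length + 1, by omega, ?_, ?_, fun s hs => ?_⟩
  · rw [← take_drop_eq_window _ _ (by omega), hy, List.drop_zero, List.take_append]
    simp
  · rw [← take_drop_eq_window _ _ (by omega), ← take_drop_eq_window _ _ (by omega), List.drop_zero]
    have h1 := List.suffix_iff_eq_drop.1 hsuf
    rw [List.length_replicate, hlen, show i + (z.length + 1) - i = z.length + 1 by omega] at h1
    rw [← h1, List.take_of_length_le (by simp), hy, List.take_left' (by simp)]
  · refine hfac _ (by simp) ?_
    rw [isInfix_iff_window _ _ false, length_window]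
    exact ⟨s, by omega, rfl⟩

theorem not_periodic_of_window_eq_replicate_append {f : ℕ → Bool} {s i p : ℕ} (hp : 0 < p)
    (hpi : p ≤ i) (h : window f s (i + 1) = List.replicate i false ++ [true]) :
    ¬ Function.Periodic f p := by
  intro hf
  have h1 : ∀ k < i, f (s + k) = false := by
    intro k hk
    have := congrArg (fun l => l[k]?) h
    simpa [window, List.getElem?_append, hk, show k < i + 1 by omega] using this
  have h2 : f (s + i) = true := by
    have := congrArg (fun l => l[i]?) h
    simpa [window, List.getElem?_append] using this
  have h3 := h1 (i - p) (by omega)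
  rw [← hf, add_assoc, Nat.sub_add_cancel hpi, h2] at h3
  exact absurd h3 (by decide)

open Classical in
theorem card_maxCircuitEdges_add_le (w : List Bool) (i : ℕ) :
    #(maxCircuitEdges w i) + (if i ∈ specialOrders w then 1 else 0) + #(factors w i) ≤
      #(factors w (i + 1)) + 1 := by
  set e₀ : List Bool := List.replicate i false ++ [true] with he₀
  set N : Finset (List Bool) := if i ∈ specialOrders w then {e₀} else ∅ with hN
  have hNcard : #N = if i ∈ specialOrders w then 1 else 0 := by
    rw [hN]; split_ifs <;> simp
  have hmemN : ∀ e, e ∈ N ↔ i ∈ specialOrders w ∧ e = e₀ := by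
    intro e; rw [hN]; split_ifs with h <;> simp [h]
  have hDE : maxCircuitEdges w i ⊆ factors w (i + 1) := filter_subset _ _
  have hNE : N ⊆ factors w (i + 1) := by
    intro e he
    obtain ⟨hs, rfl⟩ := (hmemN e).1 he
    obtain ⟨f, t, ht, hf, -, hw⟩ := exists_closed_walk_of_mem_specialOrders hs
    exact mem_factors.2 ⟨by rw [he₀, ← hf]; exact hw 0 ht, by simp [he₀]⟩
  have hdisj : Disjoint (maxCircuitEdges w i) N := by
    refine disjoint_left.2 fun e he heN => ?_
    obtain ⟨-, rfl⟩ := (hmemN e).1 heN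
    obtain ⟨-, f, p, hp, hpi, hf, hfe, -⟩ := mem_filter.1 he
    exact not_periodic_of_window_eq_replicate_append hp hpi hfe.symm hf
  have hcard := card_sdiff_add_card_eq_card (union_subset hDE hNE)
  rw [card_union_of_disjoint hdisj, hNcard] at hcard
  have hmain := card_le_card_add_one_of_connected (factors w i)
    (factors w (i + 1) \ (maxCircuitEdges w i ∪ N)) (List.take i) List.tail
    (window (fun k => w.getD k false) 0 i) fun g hg => ?_
  · omega
  have hX : ∀ f s, window f s (i + 1) <:+: w → window f s (i + 1) ∉ maxCircuitEdges w i →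
      window f s (i + 1) ∉ N → g (window f s i) = g (window f (s + 1) i) := by
    intro f s hw hD hN
    rw [← take_window_succ, ← tail_window_succ]
    exact hg _ (by simp [mem_factors, hw, hD, hN])
  have hD : ∀ e ∈ maxCircuitEdges w i, g (e.take i) = g e.tail := by
    by_contra! hbad
    obtain ⟨e, he, hmin⟩ := exists_min_image
      {e ∈ maxCircuitEdges w i | g (e.take i) ≠ g e.tail} id
      (by simpa [Finset.Nonempty] using hbad)
    obtain ⟨heD, hne⟩ := mem_filter.1 he
    obtain ⟨-, f, p, hp, hpi, hf, rfl, hmax⟩ := mem_filter.1 heD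
    rw [take_window_succ, tail_window_succ] at hne
    refine hne (potential_eq_of_closed_walk g f i p hp ?_ fun s _ hs => ?_)
    · simpa using hf.window 0 i
    · by_cases hsD : window f s (i + 1) ∈ maxCircuitEdges w i
      · by_contra hsne
        rw [← take_window_succ, ← tail_window_succ] at hsne
        exact hs ((hmax s).2.antisymm (hmin _ (mem_filter.2 ⟨hsD, hsne⟩)))
      · refine hX f s (hmax s).1 hsD fun h => ?_
        exact not_periodic_of_window_eq_replicate_append hp hpi ((hmemN _).1 h).2 hf
  have hE : ∀ f s, window f s (i + 1) <:+: w → window f s (i + 1) ∉ N →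
      g (window f s i) = g (window f (s + 1) i) := by
    intro f s hw hsN
    by_cases hsD : window f s (i + 1) ∈ maxCircuitEdges w i
    · rw [← take_window_succ, ← tail_window_succ]
      exact hD _ hsD
    · exact hX f s hw hsD hsN
  have hall : ∀ f s, window f s (i + 1) <:+: w →
      g (window f s i) = g (window f (s + 1) i) := by
    intro f s hw
    by_cases hsN : window f s (i + 1) ∈ N
    · obtain ⟨hs, he⟩ := (hmemN _).1 hsN
      obtain ⟨f', t, ht, hf', hclosed, hw'⟩ := exists_closed_walk_of_mem_specialOrders hs
      rw [← take_window_succ, ← tail_window_succ, he, he₀, ← hf', take_window_succ,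
        tail_window_succ]
      refine potential_eq_of_closed_walk g f' i t ht hclosed fun s hst hne => ?_
      exact hE _ _ (hw' s hst) fun h => hne (((hmemN _).1 h).2.trans hf'.symm)
    · exact hE f s hw hsN
  intro v hv
  obtain ⟨hvw, hvl⟩ := mem_factors.1 hv
  obtain ⟨s, hs, hvs⟩ := (isInfix_iff_window w v false).1 hvw
  rw [hvs, hvl]
  rw [hvl] at hs
  clear hvs
  induction s with
  | zero => rfl
  | succ s ih =>
    rw [← ih (by omega)]
    refine (hall _ s ?_).symm
    rw [isInfix_iff_window _ _ false, length_window]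
    exact ⟨s, by omega, rfl⟩

end SpecialCircuit

theorem power_count_plus_special_circuits_bound (w : List Bool) :
    numPowers w +
      Set.ncard {i : ℕ | 1 ≤ i ∧ i ≤ w.length ∧
        ∃ z : List Bool, z ≠ [] ∧ z.head? = some true ∧
          List.replicate i false <:+ (List.replicate i false ++ z) ∧
          ∀ v : List Bool, v.length = i + 1 →
            v <:+: (List.replicate i false ++ z) → v <:+: w} ≤
      w.length - w.toFinset.card := by
  classical
  change numPowers w + (specialOrders w).ncard ≤ _
  have hspec : (specialOrders w).ncard =
      ∑ i ∈ Ico 1 w.length, if i ∈ specialOrders w then 1 else 0 := by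
    rw [← card_filter, ← Set.ncard_coe_finset]
    congr 1
    ext i
    simp only [coe_filter, mem_Ico, Set.mem_ofPred_eq]
    refine ⟨fun hi => ⟨⟨hi.1, ?_⟩, hi⟩, fun hi => hi.2⟩
    obtain ⟨f, t, ht, -, -, hw⟩ := exists_closed_walk_of_mem_specialOrders hi
    simpa [Nat.succ_le_iff] using (hw 0 ht).length_le
  have hpow := numPowers_le_sum_card_maxCircuitEdges w
  rcases Nat.eq_zero_or_pos w.length with h0 | hpos
  · simp only [h0, zero_le, Ico_eq_empty_of_le, sum_empty] at hpow hspec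
    omega
  have htel : ∀ n, 1 ≤ n → n ≤ w.length →
      ∑ i ∈ Ico 1 n, (#(maxCircuitEdges w i) + if i ∈ specialOrders w then 1 else 0) +
        #(factors w 1) + 1 ≤ #(factors w n) + n := by
    intro n hn
    induction n, hn using Nat.le_induction with
    | base => simp
    | succ n hn ih =>
      intro hnw
      have h1 := ih (by omega)
      have h2 := card_maxCircuitEdges_add_le w n
      rw [sum_Ico_succ_top hn]
      omega
  have hlast : #(factors w w.length) ≤ 1 := by
    refine card_image_le.trans ?_
    simp
  have hfirst : #w.toFinset ≤ #(factors w 1) := by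
    refine card_le_card_of_injOn (fun x => [x]) (fun x hx => ?_) (by simp)
    simpa [mem_factors, List.singleton_infix_iff] using hx
  have hsum := htel w.length hpos le_rfl
  rw [sum_add_distrib, ← hspec] at hsum
  omega
end
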